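/- (Harnack inequality in d-balls.) There exist constants c, c_0 > 1, depending only on the weighted graph G, such that for every x ∈ E, every real L ≥ 1, and every nonnegative function v defined on the closure of B(x, c_0·L) which is harmonic in B(x, c_0·L) (i.e. Σ_{x'~x''} p_{x'',x'} v(x') = v(x'') for every x'' ∈ B(x,c_0·L)), one has max_{B(x,L)} v ≤ c · min_{B(x,L)} v. -/

import Mathlib

open MeasureTheory Filter Set
open scoped ENNReal NNReal Topology Classical

noncomputable section

/-- The weighted graph `G`: an infinite connected graph of bounded degree, with a weight
`ρG` which is uniformly bounded and uniformly positive on edges, `α`-Ahlfors regular. -/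
structure GraphSetup where
  V : Type
  infV : Infinite V
  adjG : V → V → Prop
  adjG_symm : ∀ {y y'}, adjG y y' → adjG y' y
  adjG_irrefl : ∀ y, ¬adjG y y
  /-- `dG` is the graph distance on `G`; this characterization also encodes connectedness. -/
  dG : V → V → ℕ
  dG_spec : ∀ (y y' : V) (n : ℕ), dG y y' ≤ n ↔
    ∃ p : ℕ → V, p 0 = y ∧ p n = y' ∧ ∀ i < n, p i = p (i + 1) ∨ adjG (p i) (p (i + 1))
  ballG_fin : ∀ (y : V) (R : ℝ), {y' | (dG y y' : ℝ) ≤ R}.Finite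
  degBound : ℕ
  deg_fin : ∀ y : V, {y' | adjG y y'}.Finite
  deg_le : ∀ y : V, Nat.card {y' // adjG y y'} ≤ degBound
  ρG : V → V → ℝ
  ρG_symm : ∀ y y', ρG y y' = ρG y' y
  ρG_nonneg : ∀ y y', 0 ≤ ρG y y'
  ρG_pos_iff : ∀ y y', 0 < ρG y y' ↔ adjG y y'
  ρG_lbd : ℝ
  ρG_ubd : ℝ
  ρG_lbd_pos : 0 < ρG_lbd
  ρG_bounds : ∀ y y', adjG y y' → ρG_lbd ≤ ρG y y' ∧ ρG y y' ≤ ρG_ubd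
  α : ℝ
  β : ℝ
  α_gt_one : 1 < α
  β_ge_two : 2 ≤ β
  β_le_α_add_one : β ≤ α + 1
  cA : ℝ
  cA' : ℝ
  cA_pos : 0 < cA
  /-- `α`-Ahlfors regularity of `(G, ρG)`, lower bound. -/
  ahlfors_lb : ∀ (y : V) (R : ℝ), 1 / 2 ≤ R →
    cA * R ^ α ≤ ∑ y' ∈ (ballG_fin y R).toFinset, ∑' y'', ρG y' y''
  /-- `α`-Ahlfors regularity of `(G, ρG)`, upper bound. -/
  ahlfors_ub : ∀ (y : V) (R : ℝ), 1 / 2 ≤ R →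
    (∑ y' ∈ (ballG_fin y R).toFinset, ∑' y'', ρG y' y'') ≤ cA' * R ^ α

namespace GraphSetup

/-- The product graph `E = G × ℤ`. -/
abbrev E (S : GraphSetup) : Type := S.V × ℤ

instance (S : GraphSetup) : MeasurableSpace S.V := ⊤

/-- The exponent `ν = α - β/2`. -/
def ν (S : GraphSetup) : ℝ := S.α - S.β / 2

/-- Adjacency on `E = G × ℤ`. -/
def adjE (S : GraphSetup) (x x' : S.E) : Prop :=
  (x.2 = x'.2 ∧ S.adjG x.1 x'.1) ∨ (x.1 = x'.1 ∧ (x.2 - x'.2).natAbs = 1)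

/-- The weight on `E`: `ρG` on horizontal edges, `1` on vertical edges. -/
def ρE (S : GraphSetup) (x x' : S.E) : ℝ :=
  if x.2 = x'.2 then S.ρG x.1 x'.1
  else if x.1 = x'.1 ∧ (x.2 - x'.2).natAbs = 1 then 1 else 0

/-- `ρ(x) = Σ_{x' ~ x} ρ_{x,x'}`. -/
def ρEpt (S : GraphSetup) (x : S.E) : ℝ := ∑' x', S.ρE x x'

/-- Transition probability of the walk on `E`. -/
def ptrans (S : GraphSetup) (x x' : S.E) : ℝ := S.ρE x x' / S.ρEpt x

/-- The metric `d((y,z),(y',z')) = max (d_G(y,y'), |z - z'|^{2/β})` on `E`. -/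
def dE (S : GraphSetup) (x x' : S.E) : ℝ :=
  max (S.dG x.1 x'.1 : ℝ) (|(x.2 : ℝ) - (x'.2 : ℝ)| ^ (2 / S.β))

/-- Closed `d`-ball in `E`. -/
def ball (S : GraphSetup) (x : S.E) (r : ℝ) : Set S.E := {x' | S.dE x x' ≤ r}

/-- Vertex boundary `∂U`. -/
def vBoundary (S : GraphSetup) (U : Set S.E) : Set S.E :=
  {x | x ∉ U ∧ ∃ x' ∈ U, S.adjE x x'}

/-- Closure `U ∪ ∂U`. -/
def cl (S : GraphSetup) (U : Set S.E) : Set S.E := U ∪ S.vBoundary U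

/-- Interior vertex boundary `∂_int U`. -/
def intBoundary (S : GraphSetup) (U : Set S.E) : Set S.E :=
  {x | x ∈ U ∧ ∃ x', x' ∉ U ∧ S.adjE x x'}

/-- A nearest-neighbour path of length `n` contained in `A`. -/
def IsPathIn (S : GraphSetup) (A : Set S.E) (p : ℕ → S.E) (n : ℕ) : Prop :=
  (∀ i ≤ n, p i ∈ A) ∧ ∀ i < n, S.adjE (p i) (p (i + 1))

/-- `B₁` is connected to `B₂` by a nearest-neighbour path contained in `A`. -/
def ConnectsIn (S : GraphSetup) (A B₁ B₂ : Set S.E) : Prop :=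
  ∃ (n : ℕ) (p : ℕ → S.E), S.IsPathIn A p n ∧ p 0 ∈ B₁ ∧ p n ∈ B₂

/-- The connected component of `x` inside `A`. -/
def component (S : GraphSetup) (A : Set S.E) (x : S.E) : Set S.E :=
  {x' | S.ConnectsIn A {x} {x'}}

/-- `A` is a connected subset of `E`. -/
def IsConnectedSet (S : GraphSetup) (A : Set S.E) : Prop :=
  ∀ x ∈ A, ∀ x' ∈ A, S.ConnectsIn A {x} {x'}

/-- `C` separates `A` and `B` in `U`: the graph distance between `A` and `B` exceeds `1`
and every nearest-neighbour path from `∂A` to `∂B` remaining in `U` meets `C`. -/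
def Separates (S : GraphSetup) (A B C U : Set S.E) : Prop :=
  (∀ a ∈ A, ∀ b ∈ B, a ≠ b ∧ ¬S.adjE a b) ∧
  ∀ (n : ℕ) (p : ℕ → S.E), (∀ i ≤ n, p i ∈ U) → (∀ i < n, S.adjE (p i) (p (i + 1))) →
    p 0 ∈ S.vBoundary A → p n ∈ S.vBoundary B → ∃ i ≤ n, p i ∈ C

/-- The separation event `S_{x,L}`. -/
def sepEvent (S : GraphSetup) (x : S.E) (L : ℕ) : Set (Set S.E) :=
  {C | ∃ A₁ A₂ : Set S.E,
    A₁ ⊆ S.cl (S.ball x (3 * L)) ∧ A₂ ⊆ S.cl (S.ball x (3 * L)) ∧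
    S.IsConnectedSet A₁ ∧ S.IsConnectedSet A₂ ∧
    (∃ a ∈ A₁, ∃ a' ∈ A₁, (L : ℝ) ≤ S.dE a a') ∧
    (∃ a ∈ A₂, ∃ a' ∈ A₂, (L : ℝ) ≤ S.dE a a') ∧
    S.Separates A₁ A₂ C (S.ball x (5 * L))}

/-- A half-plane of `E = G × ℤ`: the product of a semi-infinite geodesic in `G` with `ℤ`. -/
structure HalfPlane (S : GraphSetup) where
  ray : ℕ → S.V
  geodesic : ∀ n m : ℕ, S.dG (ray n) (ray m) = Nat.dist n m

/-- The set of points of a half-plane. -/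
def HalfPlane.carrier {S : GraphSetup} (P : S.HalfPlane) : Set S.E :=
  {x | ∃ n, x.1 = P.ray n}

/-- `B₁` is connected to `B₂` by a `*`-path contained in `A ∩ 𝒫`. -/
def StarConnectsIn (S : GraphSetup) (P : S.HalfPlane) (A B₁ B₂ : Set S.E) : Prop :=
  ∃ (n : ℕ) (p : ℕ → S.E),
    (∀ i ≤ n, p i ∈ A ∧ p i ∈ P.carrier) ∧
    (∀ i < n, p i ≠ p (i + 1) ∧ S.dG (p i).1 (p (i + 1)).1 ≤ 1 ∧
      ((p i).2 - (p (i + 1)).2).natAbs ≤ 1) ∧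
    p 0 ∈ B₁ ∧ p n ∈ B₂

/-- An increasing event on `{0,1}^E` (configurations identified with subsets of `E`). -/
def IncreasingEvent (S : GraphSetup) (A : Set (Set S.E)) : Prop :=
  ∀ C C' : Set S.E, C ⊆ C' → C ∈ A → C' ∈ A

/-- A decreasing event on `{0,1}^E`. -/
def DecreasingEvent (S : GraphSetup) (A : Set (Set S.E)) : Prop :=
  ∀ C C' : Set S.E, C' ⊆ C → C ∈ A → C' ∈ A

/-- The event `A` only depends on the coordinates in `B`. -/
def DependsOn (S : GraphSetup) (A : Set (Set S.E)) (B : Set S.E) : Prop :=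
  ∀ C C' : Set S.E, C ∩ B = C' ∩ B → (C ∈ A ↔ C' ∈ A)

/-- The family `(G_{x,L})` cascades with complexity at most `lam`, with constant `c`. -/
def CascadesLe (S : GraphSetup) (Gf : S.E → ℕ → Set (Set S.E)) (lam c : ℝ) : Prop :=
  (∀ (x : S.E) (L : ℕ), 1 ≤ L → S.DependsOn (Gf x L) (S.ball x (10 * L))) ∧
  ∀ (ℓ : ℕ) (x : S.E) (L : ℕ), 1 ≤ L → 0 < ℓ → 100 ∣ ℓ →
    ∃ Λ : Finset S.E, ↑Λ ⊆ S.ball x (9 * ℓ * L) ∧ (Λ.card : ℝ) ≤ c * (ℓ : ℝ) ^ lam ∧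
      Gf x (ℓ * L) ⊆
        ⋃ x' ∈ Λ, ⋃ x'' ∈ Λ,
          ⋃ (_ : ((ℓ * L : ℕ) : ℝ) / 100 ≤ S.dE x' x''), Gf x' L ∩ Gf x'' L

/-- The length scales `L_n = ℓ₀ⁿ L₀`. -/
def Lscale (ℓ₀ L₀ n : ℕ) : ℕ := ℓ₀ ^ n * L₀

/-- Membership in `Λ_n`: an embedding of the dyadic tree of depth `n` in `E`,
with nested balls and spread-out children. -/
def IsTreeEmbed (S : GraphSetup) (ℓ₀ L₀ n : ℕ) (T : ∀ k : ℕ, (Fin k → Bool) → S.E) : Prop :=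
  ∀ k < n, ∀ (m : Fin k → Bool) (b : Bool),
    S.ball (T (k + 1) (Fin.snoc m b)) (10 * Lscale ℓ₀ L₀ (n - (k + 1))) ⊆
        S.ball (T k m) (10 * Lscale ℓ₀ L₀ (n - k)) ∧
      ((Lscale ℓ₀ L₀ (n - k) : ℝ)) / 100 ≤
        S.dE (T (k + 1) (Fin.snoc m false)) (T (k + 1) (Fin.snoc m true))

/-- The factor `1 + c₁ √K (k+1)^{-3/2} ℓ₀^{-(ν-ν')/2}`. -/
def decFactor (c₁ K νv ν' : ℝ) (ℓ₀ : ℕ) (k : ℕ) : ℝ :=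
  1 + c₁ * Real.sqrt K * ((k : ℝ) + 1) ^ (-(3 : ℝ) / 2) * (ℓ₀ : ℝ) ^ (-(νv - ν') / 2)

/-- The increasing sequence of levels `u_n⁺`. -/
def uPlusSeq (c₁ K νv ν' : ℝ) (ℓ₀ : ℕ) (u₀ : ℝ) (n : ℕ) : ℝ :=
  (∏ k ∈ Finset.range n, decFactor c₁ K νv ν' ℓ₀ k) * u₀

/-- The decreasing sequence of levels `u_n⁻`. -/
def uMinusSeq (c₁ K νv ν' : ℝ) (ℓ₀ : ℕ) (u₀ : ℝ) (n : ℕ) : ℝ :=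
  (∏ k ∈ Finset.range n, (decFactor c₁ K νv ν' ℓ₀ k)⁻¹) * u₀

/-- The limit `u_∞⁺` of `u_n⁺`. -/
def uPlusInf (c₁ K νv ν' : ℝ) (ℓ₀ : ℕ) (u₀ : ℝ) : ℝ := ⨆ n, uPlusSeq c₁ K νv ν' ℓ₀ u₀ n

/-- The limit `u_∞⁻` of `u_n⁻`. -/
def uMinusInf (c₁ K νv ν' : ℝ) (ℓ₀ : ℕ) (u₀ : ℝ) : ℝ := ⨅ n, uMinusSeq c₁ K νv ν' ℓ₀ u₀ n

/-- The error term `ε(u) = 2 e^{-K u L₀^ν ℓ₀^{ν'}} / (1 - e^{-K u L₀^ν ℓ₀^{ν'}})`. -/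
def epsDecouple (K u : ℝ) (L₀ ℓ₀ : ℕ) (νv ν' : ℝ) : ℝ :=
  2 * Real.exp (-(K * u * (L₀ : ℝ) ^ νv * (ℓ₀ : ℝ) ^ ν')) /
    (1 - Real.exp (-(K * u * (L₀ : ℝ) ^ νv * (ℓ₀ : ℝ) ^ ν')))

/-- The canonical law of the random walk on `E`, as a family of measures on trajectories. -/
structure WalkLaw (S : GraphSetup) where
  P : S.E → Measure (ℕ → S.E)
  isProb : ∀ x, IsProbabilityMeasure (P x)
  cyl : ∀ (x : S.E) (n : ℕ) (q : ℕ → S.E), q 0 = x →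
    P x {w | ∀ i ≤ n, w i = q i} =
      ENNReal.ofReal (∏ i ∈ Finset.range n, S.ptrans (q i) (q (i + 1)))
  cyl0 : ∀ (x : S.E) (q : ℕ → S.E), q 0 ≠ x → P x {w | w 0 = q 0} = 0

instance {S : GraphSetup} (W : WalkLaw S) (x : S.E) : IsProbabilityMeasure (W.P x) :=
  W.isProb x

namespace WalkLaw

variable {S : GraphSetup}

/-- `P_x[H_K < ∞]`, the probability to ever enter `K`. -/
def hitProb (W : WalkLaw S) (x : S.E) (K : Set S.E) : ℝ≥0∞ := W.P x {w | ∃ n, w n ∈ K}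

/-- `P_x[H̃_K = ∞]`, the probability never to hit `K` at a positive time. -/
def escProb (W : WalkLaw S) (x : S.E) (K : Set S.E) : ℝ≥0∞ :=
  W.P x {w | ∀ n, 1 ≤ n → w n ∉ K}

/-- `P_x[H_K < ∞, X_{H_K} = x']`, the probability to enter `K` for the first time at `x'`. -/
def entersAt (W : WalkLaw S) (x : S.E) (K : Set S.E) (x' : S.E) : ℝ≥0∞ :=
  W.P x {w | ∃ n, w n = x' ∧ ∀ m < n, w m ∉ K}

/-- The equilibrium measure `e_K`. -/
def equilibrium (W : WalkLaw S) (K : Set S.E) (x : S.E) : ℝ :=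
  if x ∈ K then (W.escProb x K).toReal * S.ρEpt x else 0

/-- The capacity `cap(K) = Σ_{x ∈ K} P_x[H̃_K = ∞] ρ(x)`. -/
def capacity (W : WalkLaw S) (K : Set S.E) : ℝ :=
  ∑' x : K, (W.escProb x.1 K).toReal * S.ρEpt x.1

/-- The Green density `g(x,x') = Σ_{n ≥ 0} P_x[X_n = x'] / ρ(x')`. -/
def green (W : WalkLaw S) (x x' : S.E) : ℝ :=
  (∑' n : ℕ, (W.P x {w | w n = x'}).toReal) / S.ρEpt x'

/-- The standing assumption `c (d(x,x') ∨ 1)^{-ν} ≤ g(x,x') ≤ c' (d(x,x') ∨ 1)^{-ν}`. -/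
def GreenBounds (W : WalkLaw S) (cg cg' : ℝ) : Prop :=
  0 < cg ∧ cg ≤ cg' ∧ ∀ x x' : S.E,
    cg * (max (S.dE x x') 1) ^ (-S.ν) ≤ W.green x x' ∧
      W.green x x' ≤ cg' * (max (S.dE x x') 1) ^ (-S.ν)

end WalkLaw

/-- Random interlacements on `E`, encoded by their canonical probability space and the
family of interlacement sets `ℐ^u`, `u ≥ 0`, with
`ℙ[𝒱^u ⊇ K] = exp(-u cap(K))` for all finite `K`. -/
structure Interlacement (S : GraphSetup) (W : WalkLaw S) where
  Ω : Type
  mΩ : MeasurableSpace Ω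
  prob : @Measure Ω mΩ
  isProb : IsProbabilityMeasure prob
  I : ℝ → Ω → Set S.E
  I_mono : ∀ u u' : ℝ, u ≤ u' → ∀ ω, I u ω ⊆ I u' ω
  vacant_law : ∀ u : ℝ, 0 ≤ u → ∀ K : Set S.E, K.Finite →
    prob {ω | Disjoint K (I u ω)} = ENNReal.ofReal (Real.exp (-(u * W.capacity K)))

namespace Interlacement

variable {S : GraphSetup} {W : WalkLaw S}

/-- The vacant set `𝒱^u = E ∖ ℐ^u`. -/
def vacant (RI : Interlacement S W) (u : ℝ) (ω : RI.Ω) : Set S.E := (RI.I u ω)ᶜ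

/-- The event that `x` lies in an infinite connected component of `𝒱^u`. -/
def percolates (RI : Interlacement S W) (x : S.E) (u : ℝ) : Set RI.Ω :=
  {ω | (S.component (RI.vacant u ω) x).Infinite}

/-- The one-arm event: `B(x,L)` is connected to `∂_int B(x,2L)` in `𝒱^u`. -/
def oneArm (RI : Interlacement S W) (x : S.E) (L : ℝ) (u : ℝ) : Set RI.Ω :=
  {ω | S.ConnectsIn (RI.vacant u ω) (S.ball x L) (S.intBoundary (S.ball x (2 * L)))}

/-- `sup_{x ∈ E} ℙ[B(x,L) ↔ ∂_int B(x,2L) in 𝒱^u]`. -/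
def oneArmSup (RI : Interlacement S W) (u : ℝ) (L : ℕ) : ℝ≥0∞ :=
  ⨆ x : S.E, RI.prob (RI.oneArm x L u)

/-- The set defining `u_*`. -/
def uStarSet (RI : Interlacement S W) : Set ℝ :=
  {u | 0 ≤ u ∧ ∀ x : S.E, RI.prob (RI.percolates x u) = 0}

/-- The critical level `u_*`. -/
def uStar (RI : Interlacement S W) : ℝ := sInf RI.uStarSet

/-- The set defining `u_**`. -/
def uStarStarSet (RI : Interlacement S W) : Set ℝ :=
  {u | 0 ≤ u ∧ Filter.liminf (fun L : ℕ => RI.oneArmSup u L) Filter.atTop = 0}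

/-- The critical level `u_**`. -/
def uStarStar (RI : Interlacement S W) : ℝ := sInf RI.uStarStarSet

/-- The `*`-crossing event for `ℐ^u` inside a half-plane. -/
def starCross (RI : Interlacement S W) (P : S.HalfPlane) (x : S.E) (L : ℝ) (u : ℝ) :
    Set RI.Ω :=
  {ω | S.StarConnectsIn P (RI.I u ω) (S.ball x L) (S.intBoundary (S.ball x (2 * L)))}

/-- `sup_{𝒫, x ∈ 𝒫} ℙ[B(x,L) ↔* ∂_int B(x,2L) in ℐ^u ∩ 𝒫]`. -/
def starSup (RI : Interlacement S W) (u : ℝ) (L : ℕ) : ℝ≥0∞ :=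
  ⨆ P : S.HalfPlane, ⨆ x : P.carrier, RI.prob (RI.starCross P x.1 L u)

/-- The set defining `ũ`. -/
def uTildeSet (RI : Interlacement S W) : Set ℝ :=
  {u | 0 ≤ u ∧ 0 < Filter.liminf (fun L : ℕ => RI.starSup u L) Filter.atTop}

/-- The critical level `ũ`. -/
def uTilde (RI : Interlacement S W) : ℝ := sInf RI.uTildeSet

/-- For an event `A` on `{0,1}^E`, the event `A^u` that the indicator of `ℐ^u` lies in `A`. -/
def eventAt (RI : Interlacement S W) (A : Set (Set S.E)) (u : ℝ) : Set RI.Ω :=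
  {ω | RI.I u ω ∈ A}

end Interlacement

end GraphSetup

open GraphSetup

namespace GraphSetup

variable {S : GraphSetup}

section Metric

lemma dG_triangle (a b c : S.V) : S.dG a c ≤ S.dG a b + S.dG b c := by
  obtain ⟨p, hp0, hpn, hp⟩ := (S.dG_spec a b _).1 le_rfl
  obtain ⟨q, hq0, hqn, hq⟩ := (S.dG_spec b c _).1 le_rfl
  refine (S.dG_spec a c _).2
    ⟨fun i => if i ≤ S.dG a b then p i else q (i - S.dG a b), by simpa using hp0, ?_, ?_⟩
  · dsimp only
    split_ifs with h
    · have h0 : S.dG b c = 0 := by omega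
      rw [h0] at hqn ⊢
      rw [add_zero, hpn, ← hqn, hq0]
    · rwa [Nat.add_sub_cancel_left]
  · intro i hi
    dsimp only
    rcases lt_trichotomy i (S.dG a b) with h | h | h
    · rw [if_pos h.le, if_pos (Nat.succ_le_of_lt h)]
      exact hp i h
    · have h1 : i + 1 - S.dG a b = 0 + 1 := by omega
      rw [if_pos h.le, if_neg (by omega), h1, h, hpn, ← hq0]
      exact hq 0 (by omega)
    · have h1 : i + 1 - S.dG a b = (i - S.dG a b) + 1 := by omega
      rw [if_neg (by omega), if_neg (by omega), h1]
      exact hq _ (by omega)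

lemma dG_comm_le (a b : S.V) : S.dG b a ≤ S.dG a b := by
  obtain ⟨p, hp0, hpn, hp⟩ := (S.dG_spec a b _).1 le_rfl
  refine (S.dG_spec b a _).2 ⟨fun i => p (S.dG a b - i), by simpa using hpn, by simpa using hp0, ?_⟩
  intro i hi
  have h1 : S.dG a b - i = (S.dG a b - (i + 1)) + 1 := by omega
  dsimp only
  rw [h1]
  exact (hp (S.dG a b - (i + 1)) (by omega)).imp Eq.symm S.adjG_symm

lemma dG_comm (a b : S.V) : S.dG a b = S.dG b a :=
  le_antisymm (dG_comm_le b a) (dG_comm_le a b)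

lemma dG_self (a : S.V) : S.dG a a = 0 :=
  Nat.le_zero.1 ((S.dG_spec a a 0).2 ⟨fun _ => a, rfl, rfl, by simp⟩)

lemma dG_le_one {a b : S.V} (h : S.adjG a b) : S.dG a b ≤ 1 :=
  (S.dG_spec a b 1).2 ⟨fun i => if i = 0 then a else b, by simp, by simp, fun i hi => by
    obtain rfl : i = 0 := by omega
    simpa using Or.inr h⟩

lemma dE_comm (x y : S.E) : S.dE x y = S.dE y x := by
  simp only [dE, dG_comm x.1 y.1, abs_sub_comm (x.2 : ℝ)]

lemma exponent_pos : 0 < 2 / S.β := div_pos two_pos (two_pos.trans_le S.β_ge_two)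

lemma dE_triangle (x y z : S.E) : S.dE x z ≤ S.dE x y + S.dE y z := by
  refine max_le ?_ ?_
  · exact le_trans (by exact_mod_cast dG_triangle x.1 y.1 z.1)
      (add_le_add (le_max_left _ _) (le_max_left _ _))
  · refine le_trans ?_ (add_le_add (le_max_right _ _) (le_max_right _ _))
    refine le_trans (Real.rpow_le_rpow (abs_nonneg _) (abs_sub_le (x.2 : ℝ) y.2 z.2)
      exponent_pos.le) ?_
    exact Real.rpow_add_le_add_rpow (abs_nonneg _) (abs_nonneg _) exponent_pos.le
      ((div_le_one (two_pos.trans_le S.β_ge_two)).2 S.β_ge_two)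

lemma dE_le_one {x y : S.E} (h : S.adjE x y) : S.dE x y ≤ 1 := by
  rcases h with ⟨h1, h2⟩ | ⟨h1, h2⟩
  · refine max_le (by exact_mod_cast dG_le_one h2) ?_
    rw [h1, sub_self, abs_zero, Real.zero_rpow exponent_pos.ne']
    exact zero_le_one
  · refine max_le (by rw [h1, dG_self]; simp) ?_
    have h3 : |(x.2 : ℝ) - y.2| = 1 := by
      rw [← Int.cast_sub, ← Int.cast_abs, Int.abs_eq_natAbs, h2]
      simp
    rw [h3, Real.one_rpow]

lemma ball_finite (x : S.E) (r : ℝ) : (S.ball x r).Finite := by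
  obtain ⟨N, hN⟩ := exists_nat_ge (r ^ (S.β / 2))
  refine ((S.ballG_fin x.1 r).prod (Set.finite_Icc (x.2 - N) (x.2 + N))).subset ?_
  intro y hy
  have hy' : S.dE x y ≤ r := hy
  have hβ : (0 : ℝ) < S.β := two_pos.trans_le S.β_ge_two
  refine ⟨(le_max_left _ _).trans hy', ?_⟩
  have h1 : |(x.2 : ℝ) - y.2| ≤ N := by
    refine le_trans ?_ hN
    have h2 := Real.rpow_le_rpow (Real.rpow_nonneg (abs_nonneg _) _)
      ((le_max_right _ _).trans hy') (div_pos hβ two_pos).le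
    rwa [← Real.rpow_mul (abs_nonneg _), show 2 / S.β * (S.β / 2) = 1 by field_simp,
      Real.rpow_one] at h2
  have h3 : |x.2 - y.2| ≤ (N : ℤ) := by exact_mod_cast h1
  rw [abs_le] at h3
  constructor <;> omega

instance countable_V : Countable S.V := by
  have := S.infV
  obtain ⟨o⟩ : Nonempty S.V := inferInstance
  have h : (Set.univ : Set S.V) = ⋃ n : ℕ, {y | (S.dG o y : ℝ) ≤ n} :=
    (Set.eq_univ_of_forall fun y => Set.mem_iUnion.2 ⟨S.dG o y, le_refl (S.dG o y : ℝ)⟩).symm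
  rw [← Set.countable_univ_iff, h]
  exact Set.countable_iUnion fun n => (S.ballG_fin o n).countable

end Metric

section Transition

lemma adjE_symm {x y : S.E} (h : S.adjE x y) : S.adjE y x :=
  h.imp (fun h => ⟨h.1.symm, S.adjG_symm h.2⟩) (fun h => ⟨h.1.symm, by omega⟩)

lemma ρE_nonneg (x y : S.E) : 0 ≤ S.ρE x y := by
  unfold ρE
  split_ifs
  exacts [S.ρG_nonneg _ _, zero_le_one, le_rfl]

lemma ρE_symm (x y : S.E) : S.ρE x y = S.ρE y x := by
  have h : (x.2 - y.2).natAbs = (y.2 - x.2).natAbs := by omega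
  simp only [ρE, S.ρG_symm x.1 y.1, eq_comm (a := x.2), eq_comm (a := x.1), h]

lemma adjE_of_ρE_ne_zero {x y : S.E} (h : S.ρE x y ≠ 0) : S.adjE x y := by
  unfold ρE at h
  split_ifs at h with h1 h2
  · exact Or.inl ⟨h1, (S.ρG_pos_iff _ _).1 (lt_of_le_of_ne (S.ρG_nonneg _ _) h.symm)⟩
  · exact Or.inr h2
  · exact absurd rfl h

lemma adjE_finite (x : S.E) : {y | S.adjE x y}.Finite :=
  (ball_finite x 1).subset fun _ h => dE_le_one h

lemma ρE_hasSum (x : S.E) : HasSum (S.ρE x) (S.ρEpt x) :=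
  (summable_of_hasFiniteSupport
    ((adjE_finite x).subset fun _ h => adjE_of_ρE_ne_zero h)).hasSum

lemma ρEpt_pos (x : S.E) : 0 < S.ρEpt x := by
  have h : S.ρE x (x.1, x.2 + 1) ≤ S.ρEpt x :=
    le_hasSum (ρE_hasSum x) _ fun y _ => ρE_nonneg x y
  exact lt_of_lt_of_le (by simp [ρE]) h

lemma ptrans_nonneg (x y : S.E) : 0 ≤ S.ptrans x y :=
  div_nonneg (ρE_nonneg x y) (ρEpt_pos x).le

lemma adjE_of_ptrans_ne_zero {x y : S.E} (h : S.ptrans x y ≠ 0) : S.adjE x y :=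
  adjE_of_ρE_ne_zero fun h0 => h (by rw [ptrans, h0, zero_div])

lemma ptrans_support_finite (x : S.E) : (Function.support (S.ptrans x)).Finite :=
  (adjE_finite x).subset fun _ h => adjE_of_ptrans_ne_zero h

lemma ρEpt_stationary (y : S.E) :
    HasSum (fun x => S.ρEpt x * S.ptrans x y) (S.ρEpt y) := by
  convert ρE_hasSum y using 2 with x
  rw [ptrans, mul_div_cancel₀ _ (ρEpt_pos x).ne', ρE_symm]

end Transition

section Balayage

/-- The reduced function of `v` on `A`: it agrees with `v` on `A`, vanishes off `U` and is
harmonic in `U \ A`. -/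
lemma exists_reduced {X : Type*} (p : X → X → ℝ) (hp : ∀ x y, 0 ≤ p x y)
    (hfin : ∀ x, (Function.support (p x)).Finite) (A U : Set X) (v : X → ℝ)
    (hv : ∀ x, 0 ≤ v x) (hharm : ∀ x ∈ U, ∑' y, p x y * v y = v x) :
    ∃ w : X → ℝ, (∀ x, 0 ≤ w x) ∧ (∀ x, w x ≤ v x) ∧ (∀ x ∈ A, w x = v x) ∧
      (∀ x ∈ U, x ∉ A → ∑' y, p x y * w y = w x) ∧ ∀ x ∉ U, x ∉ A → w x = 0 := by
  let T : (X → ℝ) → X → ℝ := fun h x =>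
    if x ∈ A then v x else if x ∈ U then ∑' y, p x y * h y else 0
  have hsum : ∀ (h : X → ℝ) x, Summable fun y => p x y * h y := fun h x =>
    summable_of_hasFiniteSupport ((hfin x).subset (Function.support_mul_subset_left _ _))
  have hmono : ∀ h h' : X → ℝ, (∀ x, h x ≤ h' x) → ∀ x, T h x ≤ T h' x := by
    intro h h' hh x
    dsimp only [T]
    split_ifs
    · exact le_rfl
    · exact (hsum h x).tsum_le_tsum (fun y => mul_le_mul_of_nonneg_left (hh y) (hp x y)) (hsum h' x)
    · exact le_rfl
  have hTnn : ∀ h : X → ℝ, (∀ x, 0 ≤ h x) → ∀ x, 0 ≤ T h x := by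
    intro h hh x
    dsimp only [T]
    split_ifs
    · exact hv x
    · exact tsum_nonneg fun y => mul_nonneg (hp x y) (hh y)
    · exact le_rfl
  let Q : Set (X → ℝ) := {h | (∀ x, 0 ≤ h x) ∧ ∀ x, T h x ≤ h x}
  have hvQ : v ∈ Q := by
    refine ⟨hv, fun x => ?_⟩
    dsimp only [T]
    split_ifs with h1 h2
    · exact le_rfl
    · exact (hharm x h2).le
    · exact hv x
  have : Nonempty Q := ⟨⟨v, hvQ⟩⟩
  let w : X → ℝ := fun x => ⨅ h : Q, h.1 x
  have hw0 : ∀ x, 0 ≤ w x := fun x => le_ciInf fun h => h.2.1 x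
  have hwle : ∀ h ∈ Q, ∀ x, w x ≤ h x := fun h hh x =>
    ciInf_le (f := fun h : Q => h.1 x) ⟨0, by rintro _ ⟨h, rfl⟩; exact h.2.1 x⟩ ⟨h, hh⟩
  have hTw : ∀ x, T w x ≤ w x := fun x =>
    le_ciInf fun h => (hmono _ _ (hwle h.1 h.2) x).trans (h.2.2 x)
  have hfix : ∀ x, T w x = w x := fun x =>
    le_antisymm (hTw x) (hwle _ ⟨hTnn w hw0, fun x => hmono _ _ hTw x⟩ x)
  refine ⟨w, hw0, hwle v hvQ, fun x hx => ?_, fun x hx hxA => ?_, fun x hx hxA => ?_⟩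
  · rw [← hfix x]; simp only [T, if_pos hx]
  · conv_rhs => rw [← hfix x]
    simp only [T, if_neg hxA, if_pos hx]
  · rw [← hfix x]; simp only [T, if_neg hxA, if_neg hx]

/-- Integrating `P w` against `m` amounts to integrating `w` against `m P`. -/
lemma sum_mul_transition {w : S.E → ℝ} {F : Finset S.E} (hwF : ∀ z ∉ F, w z = 0)
    (hF : ∀ z z', w z' ≠ 0 → S.ptrans z z' ≠ 0 → z ∈ F) {m m' : S.E → ℝ}
    (hm : ∀ z', HasSum (fun z => m z * S.ptrans z z') (m' z')) :
    ∑ z ∈ F, m z * ∑' z', S.ptrans z z' * w z' = ∑ z ∈ F, m' z * w z := by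
  have h1 : ∀ z, ∑' z', S.ptrans z z' * w z' = ∑ z' ∈ F, S.ptrans z z' * w z' := fun z =>
    tsum_eq_sum fun z' hz' => by rw [hwF z' hz', mul_zero]
  simp only [h1, Finset.mul_sum]
  rw [Finset.sum_comm]
  refine Finset.sum_congr rfl fun z' _ => ?_
  by_cases hw : w z' = 0
  · simp [hw]
  · have h2 : m' z' = ∑ z ∈ F, m z * S.ptrans z z' := by
      rw [← (hm z').tsum_eq]
      refine tsum_eq_sum fun z hz => ?_
      by_contra hne
      exact hz (hF z z' hw (right_ne_zero_of_mul hne))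
    rw [h2, Finset.sum_mul]
    exact Finset.sum_congr rfl fun z _ => by ring

end Balayage

namespace WalkLaw

variable (W : WalkLaw S)

lemma measure_zero_eq (x z : S.E) : (W.P x {w | w 0 = z}).toReal = if z = x then 1 else 0 := by
  split_ifs with h
  · have := W.cyl x 0 (fun _ => x) rfl
    subst h
    simp_all
  · rw [W.cyl0 x (fun _ => z) h, ENNReal.toReal_zero]

lemma measure_cyl_succ (x : S.E) (n : ℕ) (s : ℕ → S.E) (z' : S.E) :
    W.P x ({w | ∀ i ≤ n, w i = s i} ∩ {w | w (n + 1) = z'}) =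
      W.P x {w | ∀ i ≤ n, w i = s i} * ENNReal.ofReal (S.ptrans (s n) z') := by
  by_cases h0 : s 0 = x
  · have hset : {w : ℕ → S.E | ∀ i ≤ n, w i = s i} ∩ {w | w (n + 1) = z'} =
        {w | ∀ i ≤ n + 1, w i = Function.update s (n + 1) z' i} := by
      ext w
      constructor
      · rintro ⟨h1, h2⟩ i hi
        rcases hi.lt_or_eq with h | rfl
        · rw [Function.update_of_ne h.ne]
          exact h1 i (Nat.le_of_lt_succ h)
        · rwa [Function.update_self]
      · intro h
        refine ⟨fun i hi => ?_, ?_⟩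
        · have := h i (by omega)
          rwa [Function.update_of_ne (by omega)] at this
        · have := h (n + 1) le_rfl
          rwa [Function.update_self] at this
    rw [hset, W.cyl x (n + 1) _ (by rwa [Function.update_of_ne (by omega)]), W.cyl x n s h0,
      Finset.prod_range_succ, ENNReal.ofReal_mul (Finset.prod_nonneg fun i _ => ptrans_nonneg _ _)]
    congr 2
    · refine Finset.prod_congr rfl fun i hi => ?_
      have := Finset.mem_range.1 hi
      rw [Function.update_of_ne (by omega), Function.update_of_ne (by omega)]
    · rw [Function.update_of_ne (by omega), Function.update_self]
  · have h : W.P x {w | ∀ i ≤ n, w i = s i} = 0 :=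
      measure_mono_null (fun w hw => hw 0 (Nat.zero_le _)) (W.cyl0 x s h0)
    rw [h, zero_mul]
    exact measure_mono_null Set.inter_subset_left h

lemma measure_eq_tsum_fiber {Y : Type*} [Countable Y] [MeasurableSpace Y]
    [MeasurableSingletonClass Y] {X : Type*} [MeasurableSpace X] (μ : Measure X) {π : X → Y}
    (hπ : Measurable π) (A : Set X) : μ A = ∑' y, μ (π ⁻¹' {y} ∩ A) := by
  have h := tsum_measure_preimage_singleton (μ := μ.restrict A) (f := π) Set.countable_univ
    (fun y _ => hπ (measurableSet_singleton y))
  rw [Set.preimage_univ, Measure.restrict_apply_univ,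
    tsum_univ fun y => μ.restrict A (π ⁻¹' {y})] at h
  rw [← h]
  exact tsum_congr fun y => Measure.restrict_apply (hπ (measurableSet_singleton y))

/-- The Markov property at a fixed time. -/
lemma measure_step (x : S.E) (n : ℕ) (z z' : S.E) :
    W.P x ({w | w n = z} ∩ {w | w (n + 1) = z'}) =
      W.P x {w | w n = z} * ENNReal.ofReal (S.ptrans z z') := by
  let π : (ℕ → S.E) → (Fin (n + 1) → S.E) := fun w i => w i
  have hπ : Measurable π := measurable_pi_lambda _ fun i => measurable_pi_apply _
  rw [measure_eq_tsum_fiber (W.P x) hπ, measure_eq_tsum_fiber (W.P x) hπ {w | w n = z},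
    ← ENNReal.tsum_mul_right]
  refine tsum_congr fun s => ?_
  let s' : ℕ → S.E := fun i => if h : i < n + 1 then s ⟨i, h⟩ else z
  have hs : π ⁻¹' {s} = {w | ∀ i ≤ n, w i = s' i} := by
    ext w
    simp only [Set.mem_preimage, Set.mem_singleton_iff, Set.mem_ofPred_eq, funext_iff, π]
    constructor
    · intro h i hi
      have hi' : s' i = s ⟨i, Nat.lt_succ_of_le hi⟩ := dif_pos _
      exact (h ⟨i, Nat.lt_succ_of_le hi⟩).trans hi'.symm
    · intro h i
      exact (h i (Nat.le_of_lt_succ i.2)).trans (dif_pos i.2)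
  rw [hs, ← Set.inter_assoc]
  by_cases hz : s' n = z
  · have hsub : {w : ℕ → S.E | ∀ i ≤ n, w i = s' i} ∩ {w | w n = z} =
        {w | ∀ i ≤ n, w i = s' i} :=
      Set.inter_eq_left.2 fun w hw => (hw n le_rfl).trans hz
    rw [hsub, W.measure_cyl_succ, hz]
  · have hsub : {w : ℕ → S.E | ∀ i ≤ n, w i = s' i} ∩ {w | w n = z} = ∅ :=
      Set.eq_empty_of_forall_notMem fun w hw => hz ((hw.1 n le_rfl).symm.trans hw.2)
    rw [hsub]
    simp

lemma hasSum_step (x : S.E) (n : ℕ) (z' : S.E) :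
    HasSum (fun z => (W.P x {w | w n = z}).toReal * S.ptrans z z')
      (W.P x {w | w (n + 1) = z'}).toReal := by
  have h := measure_eq_tsum_fiber (W.P x) (measurable_pi_apply n) {w | w (n + 1) = z'}
  have hpre : ∀ z : S.E, (fun w : ℕ → S.E => w n) ⁻¹' {z} = {w | w n = z} := fun z => by
    ext w
    simp
  simp only [hpre] at h
  have h1 : ∀ z, (W.P x ({w | w n = z} ∩ {w | w (n + 1) = z'})).toReal =
      (W.P x {w | w n = z}).toReal * S.ptrans z z' := fun z => by
    rw [W.measure_step, ENNReal.toReal_mul, ENNReal.toReal_ofReal (ptrans_nonneg _ _)]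
  simp only [← h1]
  have hfin : ∑' z, W.P x ({w | w n = z} ∩ {w | w (n + 1) = z'}) ≠ ∞ := by
    rw [← h]
    exact measure_ne_top _ _
  rw [h, ENNReal.tsum_toReal_eq (ENNReal.ne_top_of_tsum_ne_top hfin)]
  exact ENNReal.hasSum_toReal hfin

variable {W} in
lemma GreenBounds.summable {cg cg' : ℝ} (hG : W.GreenBounds cg cg') (x z : S.E) :
    Summable fun n : ℕ => (W.P x {w | w n = z}).toReal := by
  by_contra h
  have h1 := (hG.2.2 x z).1
  rw [green, tsum_eq_zero_of_not_summable h, zero_div] at h1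
  exact absurd h1 (not_le.2 (mul_pos hG.1
    (Real.rpow_pos_of_pos (lt_of_lt_of_le one_pos (le_max_right _ _)) _)))

variable {W} in
/-- A finitely supported function is the Green potential of `w - P w`. -/
lemma GreenBounds.potential {cg cg' : ℝ} (hG : W.GreenBounds cg cg') {w : S.E → ℝ}
    {F : Finset S.E} (hwF : ∀ z ∉ F, w z = 0)
    (hF : ∀ z z', w z' ≠ 0 → S.ptrans z z' ≠ 0 → z ∈ F) (y : S.E) :
    ∑ z ∈ F, W.green y z * (S.ρEpt z * (w z - ∑' z', S.ptrans z z' * w z')) = w y := by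
  set f : S.E → ℝ := fun z => w z - ∑' z', S.ptrans z z' * w z' with hf
  let a : ℕ → S.E → ℝ := fun n z => (W.P y {w | w n = z}).toReal
  let A : ℕ → ℝ := fun n => ∑ z ∈ F, a n z * w z
  have hstep : ∀ n, ∑ z ∈ F, a n z * f z = A n - A (n + 1) := fun n => by
    simp only [hf, mul_sub, Finset.sum_sub_distrib]
    rw [sum_mul_transition hwF hF (m' := a (n + 1)) (W.hasSum_step y n)]
  have hA0 : A 0 = w y := by
    simp only [A, a, W.measure_zero_eq, ite_mul, one_mul, zero_mul, Finset.sum_ite_eq']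
    split_ifs with h
    · rfl
    · exact (hwF y h).symm
  have hAlim : Tendsto A atTop (𝓝 0) := by
    have : Tendsto A atTop (𝓝 (∑ z ∈ F, 0 * w z)) :=
      tendsto_finsetSum _ fun z _ => (hG.summable y z).tendsto_atTop_zero.mul_const _
    simpa using this
  have hsum : HasSum (fun n => ∑ z ∈ F, a n z * f z) (∑ z ∈ F, (∑' n, a n z) * f z) :=
    hasSum_sum fun z _ => (hG.summable y z).hasSum.mul_right _
  have hlim : Tendsto (fun N => ∑ n ∈ Finset.range N, ∑ z ∈ F, a n z * f z) atTop
      (𝓝 (w y - 0)) := by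
    simp only [hstep, Finset.sum_range_sub', hA0]
    exact tendsto_const_nhds.sub hAlim
  have heq := tendsto_nhds_unique hsum.tendsto_sum_nat hlim
  rw [sub_zero] at heq
  rw [← heq]
  refine Finset.sum_congr rfl fun z _ => ?_
  rw [green, ← mul_assoc, div_mul_cancel₀ _ (ρEpt_pos z).ne']

end WalkLaw

lemma sum_ρEpt_mul_laplacian {w : S.E → ℝ} {F : Finset S.E} (hwF : ∀ z ∉ F, w z = 0)
    (hF : ∀ z z', w z' ≠ 0 → S.ptrans z z' ≠ 0 → z ∈ F) :
    ∑ z ∈ F, S.ρEpt z * (w z - ∑' z', S.ptrans z z' * w z') = 0 := by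
  simp only [mul_sub, Finset.sum_sub_distrib]
  rw [sum_mul_transition hwF hF ρEpt_stationary, sub_self]

/-- Two-sided bound for the potential of a charge of total mass zero, whose positive and negative
parts are seen through kernels `k` in `[b, a]` and `[0, e]` respectively. -/
lemma exists_mass_bounds {X ι : Type*} (F : Finset X) (φ : X → ℝ) (hφ : ∑ z ∈ F, φ z = 0)
    (k : ι → X → ℝ) (Y : Set ι) {a b e : ℝ} (hk0 : ∀ y z, 0 ≤ k y z)
    (hpos : ∀ y ∈ Y, ∀ z, 0 < φ z → b ≤ k y z ∧ k y z ≤ a)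
    (hneg : ∀ y ∈ Y, ∀ z, φ z < 0 → k y z ≤ e) :
    ∃ m : ℝ, 0 ≤ m ∧ ∀ y ∈ Y,
      ∑ z ∈ F, k y z * φ z ≤ a * m ∧ (b - e) * m ≤ ∑ z ∈ F, k y z * φ z := by
  have hdec : ∀ z, φ z = max (φ z) 0 - max (-φ z) 0 := fun z => by
    rcases le_total (φ z) 0 with h | h
    · rw [max_eq_right h, max_eq_left (neg_nonneg.2 h)]; ring
    · rw [max_eq_left h, max_eq_right (neg_nonpos.2 h)]; ring
  have hm : ∑ z ∈ F, max (φ z) 0 = ∑ z ∈ F, max (-φ z) 0 := by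
    rw [← sub_eq_zero, ← Finset.sum_sub_distrib]
    exact (Finset.sum_congr rfl fun z _ => (hdec z).symm).trans hφ
  refine ⟨∑ z ∈ F, max (φ z) 0, Finset.sum_nonneg fun z _ => le_max_right _ _, fun y hy => ?_⟩
  constructor
  · rw [Finset.mul_sum]
    refine Finset.sum_le_sum fun z _ => ?_
    rcases le_or_gt (φ z) 0 with h | h
    · rw [max_eq_right h, mul_zero]
      exact mul_nonpos_of_nonneg_of_nonpos (hk0 y z) h
    · rw [max_eq_left h.le]
      exact mul_le_mul_of_nonneg_right (hpos y hy z h).2 h.le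
  · rw [sub_mul]
    nth_rw 2 [hm]
    rw [Finset.mul_sum, Finset.mul_sum, ← Finset.sum_sub_distrib]
    refine Finset.sum_le_sum fun z _ => ?_
    rcases lt_trichotomy (φ z) 0 with h | h | h
    · rw [max_eq_right h.le, max_eq_left (neg_nonneg.2 h.le)]
      nlinarith [hneg y hy z h]
    · simp [h]
    · rw [max_eq_left h.le, max_eq_right (neg_nonpos.2 h.le), mul_zero, sub_zero]
      exact mul_le_mul_of_nonneg_right (hpos y hy z h).1 h.le

lemma ν_pos : 0 < S.ν := by
  have := S.α_gt_one
  have := S.β_le_α_add_one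
  unfold ν
  linarith

/-- The reduced function of `v` on `B(x,3L)` is a potential of a charge that sits near the boundary
of `B(x,3L)` (positive part) and outside `B(x,R)` (negative part). -/
lemma WalkLaw.GreenBounds.harmonic_bounds {W : WalkLaw S} {cg cg' : ℝ}
    (hG : W.GreenBounds cg cg') (x : S.E) {L R : ℝ} (hL : 1 ≤ L) (hR : 5 * L ≤ R)
    {v : S.E → ℝ} (hv : ∀ y, 0 ≤ v y)
    (hharm : ∀ y ∈ S.ball x R, ∑' y', S.ptrans y y' * v y' = v y) :
    ∃ m : ℝ, 0 ≤ m ∧ ∀ y ∈ S.ball x L, v y ≤ cg' * L ^ (-S.ν) * m ∧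
      (cg * (4 * L) ^ (-S.ν) - cg' * (R - L) ^ (-S.ν)) * m ≤ v y := by
  have hν : -S.ν ≤ 0 := neg_nonpos.2 ν_pos.le
  have hcg' : 0 ≤ cg' := hG.1.le.trans hG.2.1
  have hAU : S.ball x (3 * L) ⊆ S.ball x R := fun y (hy : S.dE x y ≤ 3 * L) =>
    hy.trans (by linarith)
  obtain ⟨w, hw0, hwv, hwA, hwU, hwout⟩ := exists_reduced S.ptrans ptrans_nonneg
    ptrans_support_finite (S.ball x (3 * L)) (S.ball x R) v hv hharm
  have hwU' : ∀ z ∉ S.ball x R, w z = 0 := fun z hz => hwout z hz fun h => hz (hAU h)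
  have hsum : ∀ (h : S.E → ℝ) z, Summable fun y => S.ptrans z y * h y := fun h z =>
    summable_of_hasFiniteSupport
      ((ptrans_support_finite z).subset (Function.support_mul_subset_left _ _))
  let F : Finset S.E := (ball_finite x (R + 1)).toFinset
  have hwF : ∀ z ∉ F, w z = 0 := fun z hz => hwU' z fun h => hz
    ((ball_finite x (R + 1)).mem_toFinset.2 (le_trans (show S.dE x z ≤ R from h) (by linarith)))
  have hF : ∀ z z', w z' ≠ 0 → S.ptrans z z' ≠ 0 → z ∈ F := by
    intro z z' h1 h2
    have h3 : S.dE x z' ≤ R := by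
      by_contra h
      exact h1 (hwU' z' h)
    have h4 := dE_le_one (adjE_symm (adjE_of_ptrans_ne_zero h2))
    exact (ball_finite x (R + 1)).mem_toFinset.2
      ((dE_triangle x z' z).trans (add_le_add h3 h4))
  let φ : S.E → ℝ := fun z => S.ρEpt z * (w z - ∑' z', S.ptrans z z' * w z')
  have hφpos : ∀ z, 0 < φ z → 2 * L ≤ S.dE x z ∧ S.dE x z ≤ 3 * L := by
    intro z hz
    have hz' : ∑' z', S.ptrans z z' * w z' < w z :=
      sub_pos.1 (pos_of_mul_pos_right hz (ρEpt_pos z).le)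
    have hzA : z ∈ S.ball x (3 * L) := by
      by_contra hzA
      by_cases hzU : z ∈ S.ball x R
      · exact hz'.ne (hwU z hzU hzA)
      · rw [hwU' z hzU] at hz'
        exact absurd hz' (not_lt.2 (tsum_nonneg fun y => mul_nonneg (ptrans_nonneg z y) (hw0 y)))
    refine ⟨?_, hzA⟩
    by_contra! hlt
    refine hz'.ne ?_
    rw [hwA z hzA, ← hharm z (hAU hzA)]
    refine tsum_congr fun y => ?_
    by_cases hy : S.ptrans z y = 0
    · rw [hy, zero_mul, zero_mul]
    · rw [hwA y]
      have h4 := dE_le_one (adjE_of_ptrans_ne_zero hy)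
      exact (dE_triangle x z y).trans (by linarith)
  have hφneg : ∀ z, φ z < 0 → R < S.dE x z := by
    intro z hz
    by_contra! hzU
    refine absurd hz (not_lt.2 (mul_nonneg (ρEpt_pos z).le (sub_nonneg.2 ?_)))
    by_cases hzA : z ∈ S.ball x (3 * L)
    · rw [hwA z hzA, ← hharm z hzU]
      exact (hsum w z).tsum_le_tsum
        (fun y => mul_le_mul_of_nonneg_left (hwv y) (ptrans_nonneg z y)) (hsum v z)
    · exact (hwU z hzU hzA).le
  have hgreen0 : ∀ y z, 0 ≤ W.green y z := fun y z =>
    (mul_nonneg hG.1.le (Real.rpow_nonneg (le_max_of_le_right zero_le_one) _)).trans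
      (hG.2.2 y z).1
  have hub : ∀ y z (r : ℝ), 0 < r → r ≤ S.dE y z → W.green y z ≤ cg' * r ^ (-S.ν) :=
    fun y z r hr h => (hG.2.2 y z).2.trans (mul_le_mul_of_nonneg_left
      (Real.rpow_le_rpow_of_nonpos hr (h.trans (le_max_left _ _)) hν) hcg')
  have hlb : ∀ y z (r : ℝ), 1 ≤ r → S.dE y z ≤ r → cg * r ^ (-S.ν) ≤ W.green y z :=
    fun y z r hr h => le_trans (mul_le_mul_of_nonneg_left
      (Real.rpow_le_rpow_of_nonpos (lt_of_lt_of_le one_pos (le_max_right _ _)) (max_le h hr) hν)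
      hG.1.le) (hG.2.2 y z).1
  obtain ⟨m, hm, hbd⟩ := exists_mass_bounds F φ (sum_ρEpt_mul_laplacian hwF hF) W.green
    (S.ball x L) (a := cg' * L ^ (-S.ν)) (b := cg * (4 * L) ^ (-S.ν))
    (e := cg' * (R - L) ^ (-S.ν)) hgreen0
    (fun y (hy : S.dE x y ≤ L) z hz => by
      have h1 := hφpos z hz
      have h2 := dE_triangle x y z
      have h3 := dE_triangle y x z
      rw [dE_comm y x] at h3
      exact ⟨hlb y z _ (by linarith) (by linarith), hub y z _ (by linarith) (by linarith)⟩)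
    (fun y (hy : S.dE x y ≤ L) z hz => by
      have h1 := hφneg z hz
      have h2 := dE_triangle x y z
      exact hub y z _ (by linarith) (by linarith))
  refine ⟨m, hm, fun y hy => ?_⟩
  have hyA : y ∈ S.ball x (3 * L) := le_trans (show S.dE x y ≤ L from hy) (by linarith)
  have h := hbd y hy
  rwa [hG.potential hwF hF y, hwA y hyA] at h

end GraphSetup

/-- Lemma 1.2 (Harnack inequality in `d`-balls): there are constants `c, c₀ > 1`, depending
only on the weighted graph `G`, such that for every `x ∈ E`, every real `L ≥ 1` and every
nonnegative function `v` on the closure of `B(x, c₀ L)` which is harmonic in `B(x, c₀ L)`,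
one has `max_{B(x,L)} v ≤ c min_{B(x,L)} v`. -/
theorem stmt12 (S : GraphSetup) (W : WalkLaw S) (cg cg' : ℝ) (hG : W.GreenBounds cg cg') :
    ∃ c c₀ : ℝ, 1 < c ∧ 1 < c₀ ∧
      ∀ (x : S.E) (L : ℝ), 1 ≤ L → ∀ v : S.E → ℝ,
        (∀ x' ∈ S.cl (S.ball x (c₀ * L)), 0 ≤ v x') →
        (∀ x'' ∈ S.ball x (c₀ * L), (∑' x', S.ptrans x'' x' * v x') = v x'') →
        ∀ x₁ ∈ S.ball x L, ∀ x₂ ∈ S.ball x L, v x₁ ≤ c * v x₂ := by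
  have hν := S.ν_pos
  have hcg : 0 < cg := hG.1
  have hcg' : 0 < cg' := hcg.trans_le hG.2.1
  have hratio : 1 ≤ cg' / cg := (one_le_div hcg).2 hG.2.1
  set t : ℝ := (2 * (cg' / cg)) ^ (1 / S.ν) with ht
  have ht1 : 1 ≤ t := Real.one_le_rpow (by linarith) (by positivity)
  have htν : t ^ (-S.ν) = (2 * (cg' / cg))⁻¹ := by
    rw [ht, ← Real.rpow_mul (by positivity), show 1 / S.ν * -S.ν = -1 by field_simp,
      Real.rpow_neg_one]
  have h4 : 1 ≤ (4 : ℝ) ^ S.ν := Real.one_le_rpow (by norm_num) hν.le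
  refine ⟨2 * 4 ^ S.ν * (cg' / cg), 1 + 4 * t, by nlinarith, by linarith, ?_⟩
  intro x L hL v hv hharm x₁ hx₁ x₂ hx₂
  have hL0 : 0 < L := by linarith
  have hcl : ∀ y ∈ S.ball x ((1 + 4 * t) * L), ∀ y', S.ptrans y y' ≠ 0 →
      max (v y') 0 = v y' := by
    intro y hy y' h
    refine max_eq_left (hv y' ?_)
    by_cases hy' : y' ∈ S.ball x ((1 + 4 * t) * L)
    · exact Or.inl hy'
    · exact Or.inr ⟨hy', y, hy, adjE_symm (adjE_of_ptrans_ne_zero h)⟩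
  have hLR : L ≤ (1 + 4 * t) * L := by nlinarith
  obtain ⟨m, hm, hbd⟩ := hG.harmonic_bounds x hL (R := (1 + 4 * t) * L) (by nlinarith)
    (v := fun y => max (v y) 0) (fun y => le_max_right _ _) (fun y hy => by
      rw [max_eq_left (hv y (Or.inl hy)), ← hharm y hy]
      refine tsum_congr fun y' => ?_
      by_cases h : S.ptrans y y' = 0
      · rw [h, zero_mul, zero_mul]
      · rw [hcl y hy y' h])
  have hmem : ∀ y ∈ S.ball x L, max (v y) 0 = v y := fun y hy =>
    max_eq_left (hv y (Or.inl (le_trans (show S.dE x y ≤ L from hy) hLR)))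
  have h1 := (hbd x₁ hx₁).1
  have h2 := (hbd x₂ hx₂).2
  rw [hmem _ hx₁] at h1
  rw [hmem _ hx₂, show (1 + 4 * t) * L - L = 4 * L * t by ring,
    Real.mul_rpow (x := 4 * L) (by positivity) (by positivity), htν,
    Real.mul_rpow (by norm_num) hL0.le,
    Real.rpow_neg (by norm_num : (0 : ℝ) ≤ 4)] at h2
  refine h1.trans (le_trans (le_of_eq ?_) (mul_le_mul_of_nonneg_left h2 (by positivity)))
  field_simp
  ring
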